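/- arXiv:2507.16610 — 7 statements merged into one kernel-verified Lean document; each statement's English description precedes it below -/
import Mathlib

section
/- Let H be a 2×2 Hermitian complex matrix with real diagonal entries h₁ = H₀₀ and h₃ = H₁₁, and let h₂ = |H₀₁| be the modulus of its off-diagonal entry. For every C ∈ [0,1], the coherence-constrained maximal work ξ₂(C) — the supremum of Tr[Hρ] − Tr[H U ρ U†] over all 2×2 density matrices ρ with C(ρ) = C and all 2×2 unitary matrices U with C(UρU†) = C — equals |h₁ − h₃|·√(1 − C²) + 2·h₂·C. -/
open Matrix BigOperators
open scoped ComplexOrder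

/-- The l1-norm of coherence of a matrix in the standard basis. -/
noncomputable def coh {d : ℕ} (ρ : Matrix (Fin d) (Fin d) ℂ) : ℝ :=
  ∑ i, ∑ j, if i ≠ j then ‖ρ i j‖ else 0

/-- A density matrix: positive semidefinite with unit trace. -/
def IsDensityMatrix {d : ℕ} (ρ : Matrix (Fin d) (Fin d) ℂ) : Prop :=
  ρ.PosSemidef ∧ ρ.trace = 1

/-- A unitary matrix. -/
def IsUnitaryMat {d : ℕ} (U : Matrix (Fin d) (Fin d) ℂ) : Prop :=
  U * Uᴴ = 1 ∧ Uᴴ * U = 1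

/-- The coherence-constrained maximal work: the supremum of Tr[Hρ] − Tr[H UρU†]
over all density matrices ρ of coherence C and all unitaries U preserving that coherence. -/
noncomputable def ccmw (d : ℕ) (H : Matrix (Fin d) (Fin d) ℂ) (C : ℝ) : ℝ :=
  sSup { w : ℝ | ∃ ρ U : Matrix (Fin d) (Fin d) ℂ,
    IsDensityMatrix ρ ∧ coh ρ = C ∧ IsUnitaryMat U ∧ coh (U * ρ * Uᴴ) = C ∧
    w = ((H * ρ).trace).re - ((H * (U * ρ * Uᴴ)).trace).re }

lemma coh_two (ρ : Matrix (Fin 2) (Fin 2) ℂ) : coh ρ = ‖ρ 0 1‖ + ‖ρ 1 0‖ := by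
  simp [coh, Fin.sum_univ_two]

lemma IsDensityMatrix.unitary_conj {d : ℕ} {ρ U : Matrix (Fin d) (Fin d) ℂ}
    (hρ : IsDensityMatrix ρ) (hU : IsUnitaryMat U) : IsDensityMatrix (U * ρ * Uᴴ) := by
  refine ⟨hρ.1.mul_mul_conjTranspose_same U, ?_⟩
  rw [Matrix.trace_mul_comm, ← Matrix.mul_assoc, hU.2, Matrix.one_mul, hρ.2]

/-- The energy of a qubit state differs from that of the maximally mixed state by at most half
of the coherence-constrained maximal work. -/
lemma abs_energy_sub_le {H ρ : Matrix (Fin 2) (Fin 2) ℂ} (hH : H.IsHermitian)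
    (hρ : IsDensityMatrix ρ) :
    |((H * ρ).trace).re - ((H 0 0).re + (H 1 1).re) / 2| ≤
      |(H 0 0).re - (H 1 1).re| * Real.sqrt (1 - coh ρ ^ 2) / 2 + ‖H 0 1‖ * coh ρ := by
  obtain ⟨hpos, htr⟩ := hρ
  have h10 : ρ 1 0 = star (ρ 0 1) := (hpos.1.apply 1 0).symm
  have hH10 : H 1 0 = star (H 0 1) := (hH.apply 1 0).symm
  have hn : ‖ρ 1 0‖ = ‖ρ 0 1‖ := by rw [h10, norm_star]
  have i0 : (ρ 0 0).im = 0 := Complex.conj_eq_iff_im.1 (hpos.1.apply 0 0)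
  have i1 : (ρ 1 1).im = 0 := Complex.conj_eq_iff_im.1 (hpos.1.apply 1 1)
  have hsum : (ρ 0 0).re + (ρ 1 1).re = 1 := by
    simpa [Matrix.trace_fin_two] using congrArg Complex.re htr
  have hdet : ‖ρ 0 1‖ ^ 2 ≤ (ρ 0 0).re * (ρ 1 1).re := by
    have h := (Complex.le_def.1 hpos.det_nonneg).1
    rw [Matrix.det_fin_two, h10] at h
    rw [← Complex.normSq_eq_norm_sq, Complex.normSq_apply]
    simp [i0, i1] at h
    linarith
  have hz : |(ρ 0 0).re - (ρ 1 1).re| ≤ Real.sqrt (1 - coh ρ ^ 2) := by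
    apply Real.abs_le_sqrt
    rw [coh_two, hn]
    nlinarith
  have henergy : ((H * ρ).trace).re - ((H 0 0).re + (H 1 1).re) / 2 =
      ((H 0 0).re - (H 1 1).re) * ((ρ 0 0).re - (ρ 1 1).re) / 2 + 2 * (H 0 1 * ρ 1 0).re := by
    rw [Matrix.trace_fin_two, Matrix.mul_apply, Matrix.mul_apply, Fin.sum_univ_two,
      Fin.sum_univ_two, h10, hH10]
    simp [i0, i1]
    linear_combination ((H 0 0).re + (H 1 1).re) / 2 * hsum
  rw [henergy]
  refine (abs_add_le _ _).trans (add_le_add ?_ ?_)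
  · rw [abs_div, abs_mul, abs_two]
    gcongr
  · rw [abs_mul, abs_two]
    have h := Complex.abs_re_le_norm (H 0 1 * ρ 1 0)
    rw [norm_mul] at h
    rw [coh_two, ← hn]
    linarith

/-- The qubit state with Bloch vector of height `z` and off-diagonal entry `C / 2 * star c`. -/
noncomputable def qubitState (z C : ℝ) (c : ℂ) : Matrix (Fin 2) (Fin 2) ℂ :=
  !![(1 + z) / 2, C / 2 * star c; C / 2 * c, (1 - z) / 2]

lemma mul_star_eq_one {c : ℂ} (hc : ‖c‖ = 1) : c * star c = 1 := by
  simpa [hc] using Complex.mul_conj' c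

lemma isDensityMatrix_qubitState {z C : ℝ} {c : ℂ} (hc : ‖c‖ = 1) (hzC : z ^ 2 + C ^ 2 = 1) :
    IsDensityMatrix (qubitState z C c) := by
  have hcc := mul_star_eq_one hc
  have hzC' : (z : ℂ) ^ 2 + (C : ℂ) ^ 2 = 1 := mod_cast hzC
  refine ⟨?_, ?_⟩
  · have h : qubitState z C c = (qubitState z C c)ᴴ * qubitState z C c := by
      simp only [Complex.star_def] at hcc
      ext i j
      have h2 : (starRingEnd ℂ) 2 = 2 := map_ofNat _ 2
      fin_cases i <;> fin_cases j <;>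
        simp [h2, qubitState, Matrix.mul_apply, Fin.sum_univ_two]
      · linear_combination -(C : ℂ) ^ 2 / 4 * hcc - hzC' / 4
      · ring
      · ring
      · linear_combination -(C : ℂ) ^ 2 / 4 * hcc - hzC' / 4
    rw [h]
    exact Matrix.posSemidef_conjTranspose_mul_self _
  · simp [qubitState, Matrix.trace_fin_two]
    ring

lemma coh_qubitState {z C : ℝ} {c : ℂ} (hc : ‖c‖ = 1) : coh (qubitState z C c) = |C| := by
  simp [coh_two, qubitState, hc]

/-- The rotation by `π` about an equatorial axis orthogonal to the Bloch vectors of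
`qubitState z C c`. -/
noncomputable def blochFlip (c : ℂ) : Matrix (Fin 2) (Fin 2) ℂ :=
  !![0, Complex.I * star c; -Complex.I * c, 0]

lemma isUnitaryMat_blochFlip {c : ℂ} (hc : ‖c‖ = 1) : IsUnitaryMat (blochFlip c) := by
  have hcc := mul_star_eq_one hc
  simp only [Complex.star_def] at hcc
  have hI := Complex.I_mul_I
  have h : blochFlip c * blochFlip c = 1 := by
    ext i j
    fin_cases i <;> fin_cases j <;> simp [blochFlip, Matrix.mul_apply, Fin.sum_univ_two] <;>
      linear_combination hcc - c * (starRingEnd ℂ) c * hI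
  have hs : (blochFlip c)ᴴ = blochFlip c := by
    ext i j
    fin_cases i <;> fin_cases j <;> simp [blochFlip]
  exact ⟨by rw [hs, h], by rw [hs, h]⟩

lemma blochFlip_conj_qubitState {z C : ℝ} {c : ℂ} (hc : ‖c‖ = 1) :
    blochFlip c * qubitState z C c * (blochFlip c)ᴴ = qubitState (-z) (-C) c := by
  have hcc := mul_star_eq_one hc
  simp only [Complex.star_def] at hcc
  have hI := Complex.I_sq
  ext i j
  fin_cases i <;> fin_cases j <;>
    simp [blochFlip, qubitState, Matrix.mul_apply, Fin.sum_univ_two]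
  all_goals ring_nf
  all_goals simp only [hI]
  · linear_combination (1 - (z : ℂ)) / 2 * hcc
  · linear_combination -(C : ℂ) / 2 * (starRingEnd ℂ) c * hcc
  · linear_combination -(C : ℂ) / 2 * c * hcc
  · linear_combination (1 + (z : ℂ)) / 2 * hcc

lemma energy_qubitState {H : Matrix (Fin 2) (Fin 2) ℂ} (hH : H.IsHermitian) (z C : ℝ) {c : ℂ}
    (hc : (‖H 0 1‖ : ℂ) = c * H 0 1) :
    ((H * qubitState z C c).trace).re =
      ((H 0 0).re + (H 1 1).re) / 2 + ((H 0 0).re - (H 1 1).re) * z / 2 + C * ‖H 0 1‖ := by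
  have hH10 : H 1 0 = star (H 0 1) := (hH.apply 1 0).symm
  have hre : ‖H 0 1‖ = (c * H 0 1).re := by rw [← hc, Complex.ofReal_re]
  have hform : (H * qubitState z C c).trace =
      H 0 0 * (((1 + z) / 2 : ℝ) : ℂ) + H 1 1 * (((1 - z) / 2 : ℝ) : ℂ) +
        ((C / 2 : ℝ) : ℂ) * (c * H 0 1 + star (c * H 0 1)) := by
    rw [Matrix.trace_fin_two, Matrix.mul_apply, Matrix.mul_apply, Fin.sum_univ_two,
      Fin.sum_univ_two, hH10]
    simp [qubitState]
    ring
  rw [hform, hre]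
  simp only [Complex.add_re, Complex.re_mul_ofReal, Complex.re_ofReal_mul, Complex.star_def,
    Complex.conj_re]
  ring

theorem stmt0 (H : Matrix (Fin 2) (Fin 2) ℂ) (hH : H.IsHermitian)
    (C : ℝ) (hC : C ∈ Set.Icc (0 : ℝ) 1) :
    ccmw 2 H C =
      |(H 0 0).re - (H 1 1).re| * Real.sqrt (1 - C ^ 2)
        + 2 * ‖H 0 1‖ * C := by
  obtain ⟨hC0, hC1⟩ := hC
  apply IsGreatest.csSup_eq
  constructor
  · obtain ⟨c, hc, hcH⟩ := Complex.exists_norm_eq_mul_self (H 0 1)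
    obtain ⟨z, hz2, hz⟩ : ∃ z : ℝ, z ^ 2 + C ^ 2 = 1 ∧
        ((H 0 0).re - (H 1 1).re) * z =
          |(H 0 0).re - (H 1 1).re| * Real.sqrt (1 - C ^ 2) := by
      have hs := Real.sq_sqrt (show 0 ≤ 1 - C ^ 2 by nlinarith)
      rcases abs_choice ((H 0 0).re - (H 1 1).re) with h | h
      · exact ⟨Real.sqrt (1 - C ^ 2), by linarith, by rw [h]⟩
      · exact ⟨-Real.sqrt (1 - C ^ 2), by rw [neg_sq]; linarith, by rw [h]; ring⟩
    refine ⟨qubitState z C c, blochFlip c, isDensityMatrix_qubitState hc hz2, ?_,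
      isUnitaryMat_blochFlip hc, ?_, ?_⟩
    · rw [coh_qubitState hc, abs_of_nonneg hC0]
    · rw [blochFlip_conj_qubitState hc, coh_qubitState hc, abs_neg, abs_of_nonneg hC0]
    · rw [blochFlip_conj_qubitState hc]
      have h1 := energy_qubitState hH z C hcH
      have h2 := energy_qubitState hH (-z) (-C) hcH
      rw [h1, h2]
      linear_combination -hz
  · rintro w ⟨ρ, U, hρ, hcoh, hU, hcoh', rfl⟩
    have h1 := abs_le.1 (abs_energy_sub_le hH hρ)
    have h2 := abs_le.1 (abs_energy_sub_le hH (hρ.unitary_conj hU))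
    rw [hcoh] at h1
    rw [hcoh'] at h2
    linarith [h1.2, h2.1]
end

section
/- Let ρ be a 2×2 density matrix with diagonal entries (1+a)/2 and (1−a)/2 (a ∈ ℝ) and off-diagonal modulus |ρ₀₁| = C/2, and let U be a 2×2 unitary matrix such that the transformed state σ = UρU† has the same l1-coherence, C(σ) = C(ρ) = C. Then the diagonal of σ equals the diagonal of ρ up to a possible swap: σ₀₀ = (1+b)/2 and σ₁₁ = (1−b)/2 with b = a or b = −a. -/
open Matrix BigOperators
open scoped ComplexOrder

/-- For a Hermitian `2 × 2` matrix the coherence is twice the off-diagonal modulus. -/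
lemma coh_eq_two_mul_norm {A : Matrix (Fin 2) (Fin 2) ℂ} (hA : A.IsHermitian) :
    coh A = 2 * ‖A 0 1‖ := by
  have h : ‖A 1 0‖ = ‖A 0 1‖ := by rw [← hA.apply 1 0, norm_star]
  simp [coh, Fin.sum_univ_two, h]
  ring

/-- The determinant of a Hermitian `2 × 2` matrix in terms of its coherence. -/
lemma det_eq_sub_coh_sq {A : Matrix (Fin 2) (Fin 2) ℂ} (hA : A.IsHermitian) :
    A.det = A 0 0 * A 1 1 - (((coh A / 2) ^ 2 : ℝ) : ℂ) := by
  have h : A 0 1 * A 1 0 = ((‖A 0 1‖ ^ 2 : ℝ) : ℂ) := by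
    rw [← hA.apply 1 0, Complex.star_def, Complex.mul_conj']
    push_cast
    rfl
  rw [det_fin_two, h, coh_eq_two_mul_norm hA, mul_div_cancel_left₀ _ two_ne_zero]

theorem stmt5 (ρ U : Matrix (Fin 2) (Fin 2) ℂ) (a C : ℝ)
    (hρ : IsDensityMatrix ρ)
    (h00 : ρ 0 0 = (((1 + a) / 2 : ℝ) : ℂ)) (h11 : ρ 1 1 = (((1 - a) / 2 : ℝ) : ℂ))
    (hoff : ‖ρ 0 1‖ = C / 2)
    (hU : IsUnitaryMat U)
    (hcohρ : coh ρ = C)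
    (hcohσ : coh (U * ρ * Uᴴ) = C) :
    ∃ b : ℝ, (b = a ∨ b = -a) ∧
      (U * ρ * Uᴴ) 0 0 = (((1 + b) / 2 : ℝ) : ℂ) ∧
      (U * ρ * Uᴴ) 1 1 = (((1 - b) / 2 : ℝ) : ℂ) := by
  have hσ : (U * ρ * Uᴴ).IsHermitian := isHermitian_mul_mul_conjTranspose U hρ.1.isHermitian
  have hdet : (U * ρ * Uᴴ).det = ρ.det := by
    rw [det_mul_right_comm, hU.1, one_mul]
  have htr : (U * ρ * Uᴴ).trace = 1 := by
    rw [trace_mul_cycle, hU.2, one_mul, hρ.2]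
  rw [det_eq_sub_coh_sq hσ, det_eq_sub_coh_sq hρ.1.isHermitian, hcohσ, hcohρ, h00, h11,
    sub_left_inj] at hdet
  rw [trace_fin_two] at htr
  have hreal : (((U * ρ * Uᴴ) 0 0).re : ℂ) = (U * ρ * Uᴴ) 0 0 := hσ.coe_re_apply_self 0
  generalize U * ρ * Uᴴ = σ at *
  generalize (σ 0 0).re = x at hreal
  have h1 : σ 1 1 = 1 - (x : ℂ) := by rw [hreal]; linear_combination htr
  rw [← hreal, h1] at hdet
  have hx : x * (1 - x) = (1 + a) / 2 * ((1 - a) / 2) := by exact_mod_cast hdet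
  refine ⟨2 * x - 1, sq_eq_sq_iff_eq_or_eq_neg.mp (by linear_combination -4 * hx), ?_, ?_⟩
  · rw [← hreal]
    push_cast
    ring
  · rw [h1]
    push_cast
    ring
end

section
/- Let H be a d×d Hermitian complex matrix and let ρ = ∑_j q_j |ψ_j⟩⟨ψ_j| be a finite convex decomposition of a d×d density matrix ρ into rank-one projectors onto unit vectors ψ_j, with q_j ≥ 0 and ∑_j q_j = 1. Then the ergotropy of ρ is bounded by the largest ergotropy in the decomposition: ξ(ρ) ≤ max_j ξ(|ψ_j⟩⟨ψ_j|). -/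
open Matrix BigOperators
open scoped ComplexOrder

/-- The ergotropy of a state ρ with respect to the Hamiltonian H:
the supremum of Tr[ρH] − Tr[UρU†H] over all unitaries U. -/
noncomputable def ergotropy {d : ℕ} (H ρ : Matrix (Fin d) (Fin d) ℂ) : ℝ :=
  sSup { w : ℝ | ∃ U : Matrix (Fin d) (Fin d) ℂ, IsUnitaryMat U ∧
    w = ((ρ * H).trace).re - ((U * ρ * Uᴴ * H).trace).re }

/-- The works extracted by unitaries from a fixed matrix are bounded above. -/
theorem bddAbove_unitary_work {d : ℕ} (H ρ : Matrix (Fin d) (Fin d) ℂ) :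
    BddAbove { w : ℝ | ∃ U : Matrix (Fin d) (Fin d) ℂ, IsUnitaryMat U ∧
      w = ((ρ * H).trace).re - ((U * ρ * Uᴴ * H).trace).re } := by
  refine ⟨((ρ * H).trace).re + ∑ i, ∑ l, (∑ k, ∑ j, ‖ρ j k‖) * ‖H l i‖, ?_⟩
  rintro w ⟨U, hU, rfl⟩
  have hentry (i j : Fin d) : ‖U i j‖ ≤ 1 :=
    entry_norm_bound_of_unitary (Matrix.mem_unitaryGroup_iff.mpr hU.1) i j
  have hbound : ‖(U * ρ * Uᴴ * H).trace‖ ≤ ∑ i, ∑ l, (∑ k, ∑ j, ‖ρ j k‖) * ‖H l i‖ := by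
    simp only [Matrix.trace, Matrix.diag_apply, Matrix.mul_apply, Matrix.conjTranspose_apply]
    refine norm_sum_le_of_le _ fun i _ => norm_sum_le_of_le _ fun l _ => ?_
    rw [norm_mul]
    gcongr
    refine norm_sum_le_of_le _ fun k _ => ?_
    rw [norm_mul, norm_star]
    refine (mul_le_of_le_one_right (norm_nonneg _) (hentry l k)).trans ?_
    refine norm_sum_le_of_le _ fun j _ => ?_
    rw [norm_mul]
    exact mul_le_of_le_one_left (norm_nonneg _) (hentry i j)
  have hre := (abs_le.mp (Complex.abs_re_le_norm (U * ρ * Uᴴ * H).trace)).1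
  linarith

/-- Ergotropy is convex in the state. -/
theorem ergotropy_sum_le {d : ℕ} {ι : Type*} [Fintype ι] (H : Matrix (Fin d) (Fin d) ℂ)
    (σ : ι → Matrix (Fin d) (Fin d) ℂ) (q : ι → ℝ) (hq : ∀ j, 0 ≤ q j) :
    ergotropy H (∑ j, (q j : ℂ) • σ j) ≤ ∑ j, q j * ergotropy H (σ j) := by
  refine csSup_le ⟨_, 1, by simp [IsUnitaryMat], rfl⟩ ?_
  rintro w ⟨U, hU, rfl⟩
  have hlin : ((((∑ j, (q j : ℂ) • σ j) * H).trace).re -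
      ((U * (∑ j, (q j : ℂ) • σ j) * Uᴴ * H).trace).re) =
      ∑ j, q j * (((σ j * H).trace).re - ((U * σ j * Uᴴ * H).trace).re) := by
    simp [Finset.mul_sum, Finset.sum_mul, Matrix.trace_sum, mul_sub, Finset.sum_sub_distrib]
  rw [hlin]
  exact Finset.sum_le_sum fun j _ => mul_le_mul_of_nonneg_left
    (le_csSup (bddAbove_unitary_work H (σ j)) ⟨U, hU, rfl⟩) (hq j)

theorem stmt7 {d n : ℕ} (hn : 0 < n) (H : Matrix (Fin d) (Fin d) ℂ)
    (hH : H.IsHermitian)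
    (ψ : Fin n → (Fin d → ℂ)) (q : Fin n → ℝ)
    (hψ : ∀ j, ∑ i, ‖ψ j i‖ ^ 2 = 1)
    (hq : ∀ j, 0 ≤ q j) (hsum : ∑ j, q j = 1)
    (ρ : Matrix (Fin d) (Fin d) ℂ) (hρ : IsDensityMatrix ρ)
    (hdecomp : ρ = ∑ j, (q j : ℂ) • vecMulVec (ψ j) (star (ψ j))) :
    ergotropy H ρ ≤
      Finset.univ.sup'
        (Finset.univ_nonempty_iff.mpr (Fin.pos_iff_nonempty.mp hn))
        (fun j => ergotropy H (vecMulVec (ψ j) (star (ψ j)))) := by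
  rw [hdecomp]
  refine (ergotropy_sum_le H _ q hq).trans ?_
  set M := Finset.univ.sup' (Finset.univ_nonempty_iff.mpr (Fin.pos_iff_nonempty.mp hn))
    fun j => ergotropy H (vecMulVec (ψ j) (star (ψ j)))
  have hM (j : Fin n) : ergotropy H (vecMulVec (ψ j) (star (ψ j))) ≤ M :=
    Finset.le_sup' (fun j => ergotropy H (vecMulVec (ψ j) (star (ψ j)))) (Finset.mem_univ j)
  calc ∑ j, q j * ergotropy H (vecMulVec (ψ j) (star (ψ j)))
      ≤ ∑ j, q j * M := Finset.sum_le_sum fun j _ => mul_le_mul_of_nonneg_left (hM j) (hq j)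
    _ = M := by rw [← Finset.sum_mul, hsum, one_mul]
end

section
/- Let ψ ∈ ℂ^d be a unit vector whose l1-norm of coherence attains the maximal value d − 1, i.e., ∑_{i≠j} |ψ_i|·|ψ_j| = d − 1. Then |ψ_i| = 1/√d for every i = 0, …, d−1; in particular, up to phases of the components, there is a unique pure state of maximal coherence. -/
open Matrix BigOperators
open scoped ComplexOrder

/-- The l1-norm of coherence of a (pure state) vector in the standard basis:
the l1-coherence of the rank-one projector |ψ⟩⟨ψ|. -/
noncomputable def cohVec {d : ℕ} (ψ : Fin d → ℂ) : ℝ :=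
  ∑ i, ∑ j, if i ≠ j then ‖ψ i‖ * ‖ψ j‖ else 0

theorem cohVec_eq_sq_sum_sub {d : ℕ} (ψ : Fin d → ℂ) :
    cohVec ψ = (∑ i, ‖ψ i‖) ^ 2 - ∑ i, ‖ψ i‖ ^ 2 := by
  rw [cohVec, sq, Finset.sum_mul_sum, ← Finset.sum_sub_distrib]
  refine Finset.sum_congr rfl fun i _ => ?_
  rw [← Finset.sum_filter, Finset.filter_ne, Finset.sum_erase_eq_sub (Finset.mem_univ i), sq]

theorem stmt9 {d : ℕ} (ψ : Fin d → ℂ)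
    (hψ : ∑ i, ‖ψ i‖ ^ 2 = 1)
    (hcoh : cohVec ψ = (d : ℝ) - 1) :
    ∀ i, ‖ψ i‖ = 1 / Real.sqrt d := by
  intro i
  have hd : (0 : ℝ) < d := by exact_mod_cast i.pos
  have hsum : ∑ j, ‖ψ j‖ = √d := by
    rw [eq_comm, Real.sqrt_eq_iff_eq_sq hd.le (by positivity)]
    linarith [cohVec_eq_sq_sum_sub ψ]
  have hzero : ∑ j, (‖ψ j‖ - 1 / √d) ^ 2 = 0 := by
    have hexpand : ∑ j, (‖ψ j‖ - 1 / √d) ^ 2 =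
        ∑ j, ‖ψ j‖ ^ 2 - 2 * (∑ j, ‖ψ j‖) * (1 / √d) + d * (1 / √d) ^ 2 := by
      simp only [sub_sq, Finset.sum_add_distrib, Finset.sum_sub_distrib, Finset.mul_sum,
        Finset.sum_mul, Finset.sum_const, Finset.card_univ, Fintype.card_fin, nsmul_eq_mul]
    have hne : √(d : ℝ) ≠ 0 := (Real.sqrt_pos.2 hd).ne'
    rw [hexpand, hψ, hsum, div_pow, Real.sq_sqrt hd.le]
    field_simp
    norm_num
  have hi := (Finset.sum_eq_zero_iff_of_nonneg fun j _ => sq_nonneg _).1 hzero i (Finset.mem_univ i)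
  exact sub_eq_zero.1 (pow_eq_zero_iff two_ne_zero |>.1 hi)
end

section
/- Let H be a d×d real diagonal matrix with diagonal entries ε_0 ≥ ε_1 ≥ … ≥ ε_{d−1}, and for C ∈ [0, d−1] define ξ^p_d(C) as the supremum of ⟨ψ, Hψ⟩ − ⟨φ, Hφ⟩ over all unit vectors ψ, φ ∈ ℂ^d whose l1-coherence equals C. Then ξ^p_d is monotonically decreasing in C: for all 0 ≤ C ≤ C' ≤ d − 1, ξ^p_d(C') ≤ ξ^p_d(C). -/
open Matrix BigOperators
open scoped ComplexOrder

/-- The pure-state coherence-constrained extractable work: the supremum of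
⟨ψ, Hψ⟩ − ⟨φ, Hφ⟩ over all unit vectors ψ, φ of l1-coherence C. -/
noncomputable def xip (d : ℕ) (H : Matrix (Fin d) (Fin d) ℂ) (C : ℝ) : ℝ :=
  sSup { w : ℝ | ∃ ψ φ : Fin d → ℂ,
    (∑ i, ‖ψ i‖ ^ 2 = 1) ∧ (∑ i, ‖φ i‖ ^ 2 = 1) ∧
    cohVec ψ = C ∧ cohVec φ = C ∧
    w = (star ψ ⬝ᵥ (H *ᵥ ψ)).re - (star φ ⬝ᵥ (H *ᵥ φ)).re }

lemma re_star_dotProduct_diagonal_mulVec {d : ℕ} (ε : Fin d → ℝ) (ψ : Fin d → ℂ) :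
    (star ψ ⬝ᵥ (Matrix.diagonal (fun i => (ε i : ℂ)) *ᵥ ψ)).re = ∑ i, ε i * ‖ψ i‖ ^ 2 := by
  simp only [dotProduct, Matrix.mulVec_diagonal, Complex.re_sum]
  refine Finset.sum_congr rfl fun i _ => ?_
  rw [← Complex.normSq_eq_norm_sq, Complex.normSq_apply]
  simp
  ring

/-- Mixing the populations of `ψ` with a basis state reaches every smaller coherence. -/
lemma exists_mix_cohVec_eq {d : ℕ} (ψ : Fin d → ℂ) (k : Fin d) {C : ℝ} (hC : 0 ≤ C)
    (hCψ : C ≤ cohVec ψ) :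
    ∃ (t : ℝ) (ψ' : Fin d → ℂ), 0 ≤ t ∧ t ≤ 1 ∧ cohVec ψ' = C ∧
      ∀ i, ‖ψ' i‖ ^ 2 = (1 - t) * ‖ψ i‖ ^ 2 + t * (if i = k then 1 else 0) := by
  let g : ℝ → Fin d → ℝ := fun t i =>
    Real.sqrt ((1 - t) * ‖ψ i‖ ^ 2 + t * (if i = k then 1 else 0))
  let f : ℝ → ℝ := fun t => cohVec (fun i => (g t i : ℂ))
  have hg : ∀ t i, ‖(g t i : ℂ)‖ = g t i := fun t i => by
    rw [Complex.norm_real, Real.norm_of_nonneg (Real.sqrt_nonneg _)]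
  have hf : ∀ t, f t = ∑ i, ∑ j, if i ≠ j then g t i * g t j else 0 := fun t => by
    simp only [f, cohVec, hg]
  have hcont : ContinuousOn f (Set.Icc 0 1) := by
    refine Continuous.continuousOn ?_
    rw [funext hf]
    refine continuous_finsetSum _ fun i _ => continuous_finsetSum _ fun j _ => ?_
    split_ifs
    · simp only [g]
      fun_prop
    · exact continuous_const
  have h0 : f 0 = cohVec ψ := by
    rw [hf]
    simp [g, cohVec]
  have h1 : f 1 = 0 := by
    rw [hf]
    refine Finset.sum_eq_zero fun i _ => Finset.sum_eq_zero fun j _ => ?_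
    by_cases hi : i = k <;> by_cases hj : j = k <;> simp [g, hi, hj]
  obtain ⟨t, ⟨ht0, ht1⟩, ht⟩ := intermediate_value_Icc' zero_le_one hcont
    (show C ∈ Set.Icc (f 1) (f 0) by rw [h0, h1]; exact ⟨hC, hCψ⟩)
  refine ⟨t, fun i => (g t i : ℂ), ht0, ht1, ht, fun i => ?_⟩
  rw [hg]
  refine Real.sq_sqrt (add_nonneg (mul_nonneg (by linarith) (by positivity))
    (mul_nonneg ht0 ?_))
  split_ifs <;> norm_num

/-- The coherence of a unit vector can be lowered without lowering its energy, for any energy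
function attaining its maximum. -/
lemma exists_cohVec_eq_energy_le {d : ℕ} (ε : Fin d → ℝ) {k : Fin d} (hk : ∀ i, ε i ≤ ε k)
    (ψ : Fin d → ℂ) (hψ : ∑ i, ‖ψ i‖ ^ 2 = 1) {C : ℝ} (hC : 0 ≤ C) (hCψ : C ≤ cohVec ψ) :
    ∃ ψ' : Fin d → ℂ, ∑ i, ‖ψ' i‖ ^ 2 = 1 ∧ cohVec ψ' = C ∧
      ∑ i, ε i * ‖ψ i‖ ^ 2 ≤ ∑ i, ε i * ‖ψ' i‖ ^ 2 := by
  obtain ⟨t, ψ', ht0, -, hcoh, h⟩ := exists_mix_cohVec_eq ψ k hC hCψ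
  have hle : ∑ i, ε i * ‖ψ i‖ ^ 2 ≤ ε k := by
    calc ∑ i, ε i * ‖ψ i‖ ^ 2 ≤ ∑ i, ε k * ‖ψ i‖ ^ 2 :=
          Finset.sum_le_sum fun i _ => mul_le_mul_of_nonneg_right (hk i) (by positivity)
      _ = ε k := by rw [← Finset.mul_sum, hψ, mul_one]
  have heq : ∑ i, ε i * ‖ψ' i‖ ^ 2 = (1 - t) * ∑ i, ε i * ‖ψ i‖ ^ 2 + t * ε k := by
    simp only [h, mul_add, Finset.sum_add_distrib, Finset.mul_sum]
    congr 1
    · exact Finset.sum_congr rfl fun i _ => by ring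
    · simp [mul_comm]
  refine ⟨ψ', ?_, hcoh, ?_⟩
  · simp only [h, Finset.sum_add_distrib, ← Finset.mul_sum, hψ]
    simp
  · rw [heq]
    nlinarith

lemma abs_energy_le {d : ℕ} (ε : Fin d → ℝ) (ψ : Fin d → ℂ) (hψ : ∑ i, ‖ψ i‖ ^ 2 = 1) :
    |∑ i, ε i * ‖ψ i‖ ^ 2| ≤ ∑ i, |ε i| := by
  refine (Finset.abs_sum_le_sum_abs _ _).trans (Finset.sum_le_sum fun i _ => ?_)
  rw [abs_mul, abs_of_nonneg (sq_nonneg ‖ψ i‖)]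
  refine mul_le_of_le_one_right (abs_nonneg _) ?_
  rw [← hψ]
  exact Finset.single_le_sum (f := fun i => ‖ψ i‖ ^ 2) (fun j _ => by positivity)
    (Finset.mem_univ i)

theorem stmt10 {d : ℕ} (ε : Fin d → ℝ)
    (hmono : ∀ i j : Fin d, i ≤ j → ε j ≤ ε i)
    (C C' : ℝ) (hC : 0 ≤ C) (hCC' : C ≤ C') (hC' : C' ≤ (d : ℝ) - 1) :
    xip d (Matrix.diagonal (fun i => (ε i : ℂ))) C' ≤
      xip d (Matrix.diagonal (fun i => (ε i : ℂ))) C := by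
  have hd : 0 < d := by
    have : (0 : ℝ) < d := by linarith
    exact_mod_cast this
  simp only [xip, re_star_dotProduct_diagonal_mulVec]
  set S : Set ℝ := {w : ℝ | ∃ ψ φ : Fin d → ℂ,
    (∑ i, ‖ψ i‖ ^ 2 = 1) ∧ (∑ i, ‖φ i‖ ^ 2 = 1) ∧ cohVec ψ = C ∧ cohVec φ = C ∧
    w = ∑ i, ε i * ‖ψ i‖ ^ 2 - ∑ i, ε i * ‖φ i‖ ^ 2} with hS
  have hbdd : BddAbove S := by
    refine ⟨∑ i, |ε i| + ∑ i, |ε i|, ?_⟩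
    rintro w ⟨ψ, φ, hψ, hφ, -, -, rfl⟩
    have h1 := abs_le.mp (abs_energy_le ε ψ hψ)
    have h2 := abs_le.mp (abs_energy_le ε φ hφ)
    linarith [h1.2, h2.1]
  refine Real.sSup_le ?_ ?_
  · rintro w ⟨ψ, φ, hψ, hφ, hcψ, hcφ, rfl⟩
    obtain ⟨ψ', hψ', hcψ', h1⟩ := exists_cohVec_eq_energy_le ε (k := ⟨0, hd⟩)
      (fun i => hmono _ _ (Nat.zero_le _)) ψ hψ hC (hCC'.trans_eq hcψ.symm)
    obtain ⟨φ', hφ', hcφ', h2⟩ := exists_cohVec_eq_energy_le (fun i => -ε i)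
      (k := ⟨d - 1, by omega⟩)
      (fun i => neg_le_neg (hmono _ _ (Nat.le_sub_one_of_lt i.isLt))) φ hφ hC
      (hCC'.trans_eq hcφ.symm)
    simp only [neg_mul, Finset.sum_neg_distrib, neg_le_neg_iff] at h2
    exact (sub_le_sub h1 h2).trans
      (le_csSup hbdd ⟨ψ', φ', hψ', hφ', hcψ', hcφ', rfl⟩)
  · rcases S.eq_empty_or_nonempty with h | ⟨w, ψ, -, hψ, -, hcψ, -, -⟩
    · rw [h, Real.sSup_empty]
    · exact le_csSup hbdd ⟨ψ, ψ, hψ, hψ, hcψ, hcψ, (sub_self _).symm⟩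
end

section
/- Let H = diag(−1, 0, 1) be the 3×3 real diagonal matrix (the normalized spin-1 operator J_z³). For every C ∈ [0, 2], the supremum of ⟨ψ, Hψ⟩ − ⟨φ, Hφ⟩ over all unit vectors ψ, φ ∈ ℂ³ whose l1-coherence equals C is ξ₃(C) = √((1 + f₃ + C/3)·(1 + f₃ − C)), where f₃ = √(1 + C)·√(1 − C/3). -/
open Matrix BigOperators
open scoped ComplexOrder

theorem cohVec_three (ψ : Fin 3 → ℂ) :
    cohVec ψ = 2 * (‖ψ 0‖ * ‖ψ 1‖ + ‖ψ 1‖ * ‖ψ 2‖ + ‖ψ 0‖ * ‖ψ 2‖) := by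
  simp [cohVec, Fin.sum_univ_three]
  ring

theorem energy_three (ψ : Fin 3 → ℂ) :
    (star ψ ⬝ᵥ (Matrix.diagonal ![(-1 : ℂ), 0, 1] *ᵥ ψ)).re = ‖ψ 2‖ ^ 2 - ‖ψ 0‖ ^ 2 := by
  simp [dotProduct, Fin.sum_univ_three, Matrix.mulVec_diagonal, Complex.sq_norm,
    Complex.normSq_apply]
  ring

/-- The quartic `x² (2 - 2 (S - x)² - x²)` is maximal over `x ≥ 0` at `x = (S + T) / 2`,
where `3 T² = 4 - S²`. -/
theorem quartic_le_max {S T x : ℝ} (hp : 0 < S + T) (hT : 3 * T ^ 2 = 4 - S ^ 2) (hx : 0 ≤ x)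
    (hq : 0 ≤ 1 - S ^ 2 + S * ((S + T) / 2)) :
    x ^ 2 * (2 - 2 * (S - x) ^ 2 - x ^ 2) ≤
      ((S + T) / 2) ^ 2 * (1 - S ^ 2 + S * ((S + T) / 2)) := by
  obtain ⟨p, rfl⟩ : ∃ p, T = 2 * p - S := ⟨(S + T) / 2, by ring⟩
  have e : (S + (2 * p - S)) / 2 = p := by ring
  rw [e] at hq ⊢
  have hp' : 0 < p := by linarith
  have hcrit : 3 * p ^ 2 = 1 - S ^ 2 + 3 * S * p := by linarith
  have hfac : p * (p ^ 2 * (1 - S ^ 2 + S * p) - x ^ 2 * (2 - 2 * (S - x) ^ 2 - x ^ 2)) =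
      (x - p) ^ 2 *
        (3 * p * x ^ 2 + 2 * (1 - S ^ 2 + S * p) * x + p * (1 - S ^ 2 + S * p)) := by
    linear_combination (2 * x ^ 3 - p * x ^ 2) * hcrit
  have hnonneg : 0 ≤ p * (p ^ 2 * (1 - S ^ 2 + S * p) -
      x ^ 2 * (2 - 2 * (S - x) ^ 2 - x ^ 2)) := by
    rw [hfac]
    positivity
  have := nonneg_of_mul_nonneg_right hnonneg hp'
  linarith

theorem stmt12 (C : ℝ) (hC : C ∈ Set.Icc (0 : ℝ) 2) :
    xip 3 (Matrix.diagonal ![(-1 : ℂ), 0, 1]) C =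
      Real.sqrt ((1 + Real.sqrt (1 + C) * Real.sqrt (1 - C / 3) + C / 3) *
        (1 + Real.sqrt (1 + C) * Real.sqrt (1 - C / 3) - C)) := by
  obtain ⟨h0, h2⟩ := hC
  have hS2 : √(1 + C) ^ 2 = 1 + C := Real.sq_sqrt (by linarith)
  have hT2 : √(1 - C / 3) ^ 2 = 1 - C / 3 := Real.sq_sqrt (by linarith)
  have hS : 0 < √(1 + C) := Real.sqrt_pos.2 (by linarith)
  have hT : 0 < √(1 - C / 3) := Real.sqrt_pos.2 (by linarith)
  have hTS : √(1 - C / 3) ≤ √(1 + C) := Real.sqrt_le_sqrt (by linarith)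
  generalize √(1 + C) = S at *
  generalize √(1 - C / 3) = T at *
  have hf : C - 1 ≤ S * T := by
    refine le_of_sq_le_sq ?_ (by positivity)
    rw [mul_pow, hS2, hT2]
    nlinarith
  have hq0 : 0 ≤ (1 + S * T - C) / 2 := by linarith
  have hp2 : ((S + T) / 2) ^ 2 = (1 + S * T + C / 3) / 2 := by
    linear_combination hS2 / 4 + hT2 / 4
  have hR : (1 + S * T + C / 3) * (1 + S * T - C) =
      (2 * ((S + T) / 2 * √((1 + S * T - C) / 2))) ^ 2 := by
    rw [mul_pow, mul_pow, Real.sq_sqrt hq0, hp2]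
    ring
  have hq : √((1 + S * T - C) / 2) ^ 2 = (1 + S * T - C) / 2 := Real.sq_sqrt hq0
  have hqn : 0 ≤ √((1 + S * T - C) / 2) := Real.sqrt_nonneg _
  generalize √((1 + S * T - C) / 2) = q at *
  have hqp : q ≤ (S + T) / 2 := by
    refine le_of_sq_le_sq ?_ (by positivity)
    rw [hq, hp2]
    linarith
  have hbound : ∀ χ : Fin 3 → ℂ, ∑ i, ‖χ i‖ ^ 2 = 1 → cohVec χ = C →
      |‖χ 2‖ ^ 2 - ‖χ 0‖ ^ 2| ≤ (S + T) / 2 * q := by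
    intro χ hn hc
    rw [Fin.sum_univ_three] at hn
    rw [cohVec_three] at hc
    have hsum : ‖χ 0‖ + ‖χ 1‖ + ‖χ 2‖ = S := by
      refine (sq_eq_sq₀ (by positivity) hS.le).1 ?_
      rw [hS2]
      linear_combination hn + hc
    have hmax := quartic_le_max (S := S) (T := T) (x := ‖χ 0‖ + ‖χ 2‖) (by linarith)
      (by linarith) (by positivity) (by nlinarith)
    have hb : S - (‖χ 0‖ + ‖χ 2‖) = ‖χ 1‖ := by linarith
    rw [hb] at hmax
    have hq' : 1 - S ^ 2 + S * ((S + T) / 2) = q ^ 2 := by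
      linear_combination -hq - hS2 / 2
    rw [hq'] at hmax
    refine abs_le_of_sq_le_sq ?_ (by positivity)
    calc (‖χ 2‖ ^ 2 - ‖χ 0‖ ^ 2) ^ 2 = (‖χ 0‖ + ‖χ 2‖) ^ 2 *
          (2 - 2 * ‖χ 1‖ ^ 2 - (‖χ 0‖ + ‖χ 2‖) ^ 2) := by
          linear_combination 2 * (‖χ 0‖ + ‖χ 2‖) ^ 2 * hn
      _ ≤ _ := by rw [mul_pow]; exact hmax
  rw [hR, Real.sqrt_sq (by positivity)]
  refine IsGreatest.csSup_eq ⟨?_, ?_⟩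
  · obtain ⟨a, ha⟩ : ∃ a, a = ((S + T) / 2 - q) / 2 := ⟨_, rfl⟩
    obtain ⟨b, hb⟩ : ∃ b, b = (S - T) / 2 := ⟨_, rfl⟩
    obtain ⟨c, hc⟩ : ∃ c, c = ((S + T) / 2 + q) / 2 := ⟨_, rfl⟩
    have ha0 : 0 ≤ a := by linarith
    have hb0 : 0 ≤ b := by linarith
    have hc0 : 0 ≤ c := by linarith
    have hn : a ^ 2 + b ^ 2 + c ^ 2 = 1 := by
      subst ha hb hc
      linear_combination 3 / 8 * hS2 + 3 / 8 * hT2 + hq / 2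
    have hcoh : 2 * (a * b + b * c + a * c) = C := by
      have hs : a + b + c = S := by linarith
      linear_combination (a + b + c + S) * hs - hn + hS2
    refine ⟨![(a : ℂ), b, c], ![(c : ℂ), b, a], ?_, ?_, ?_, ?_, ?_⟩
    · simpa [Fin.sum_univ_three] using hn
    · simp [Fin.sum_univ_three]
      linarith
    · simpa [cohVec_three, abs_of_nonneg, ha0, hb0, hc0] using hcoh
    · simp [cohVec_three, abs_of_nonneg, ha0, hb0, hc0]
      linarith
    · rw [energy_three, energy_three]
      simp
      subst ha hc
      ring
  · rintro w ⟨ψ, φ, hψ, hφ, hcψ, hcφ, rfl⟩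
    rw [energy_three, energy_three]
    have h1 := (abs_le.1 (hbound ψ hψ hcψ)).2
    have h2 := (abs_le.1 (hbound φ hφ hcφ)).1
    linarith
end

section
/- Let α > 0, φ ∈ ℝ, d ≥ 2, and let J be the d×d Hermitian matrix J = α·∑_{i=1}^{d−1} (e^{iφ}|i⟩⟨i−1| + e^{−iφ}|i−1⟩⟨i|). Then the supremum of ⟨ψ, Jψ⟩ − ⟨φ', Jφ'⟩ over all unit vectors ψ, φ' ∈ ℂ^d all of whose components have modulus 1/√d (i.e., over all pure states of maximal l1-coherence d − 1) equals 4α(1 − 1/d). -/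
open Matrix BigOperators

theorem Fin.sum_sum_ite_eq_add_one {M : Type*} [AddCommMonoid M] {n : ℕ}
    (f : Fin (n + 1) → Fin (n + 1) → M) :
    ∑ i : Fin (n + 1), ∑ j : Fin (n + 1), (if (i : ℕ) = (j : ℕ) + 1 then f i j else 0) =
      ∑ k : Fin n, f k.succ k.castSucc := by
  rw [Fin.sum_univ_succ]
  simp only [Fin.val_zero, Fin.val_succ, Nat.right_eq_add, Nat.add_eq_zero_iff, one_ne_zero,
    and_false, if_false, Finset.sum_const_zero, zero_add]
  refine Finset.sum_congr rfl fun k _ => ?_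
  rw [Finset.sum_eq_single k.castSucc]
  · simp
  · intro j _ hj
    rw [if_neg]
    intro h
    apply hj
    ext
    simp
    omega
  · simp

/-- The Hermitian hopping matrix with amplitude `α` and phase `φ` on a chain of `d` sites. -/
noncomputable def hoppingMatrix (d : ℕ) (α φ : ℝ) : Matrix (Fin d) (Fin d) ℂ :=
  Matrix.of fun i j =>
    if (i : ℕ) = (j : ℕ) + 1 then (α : ℂ) * Complex.exp (Complex.I * (φ : ℂ))
    else if (j : ℕ) = (i : ℕ) + 1 then (α : ℂ) * Complex.exp (-Complex.I * (φ : ℂ))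
    else 0

theorem dotProduct_hoppingMatrix_mulVec {n : ℕ} (α φ : ℝ) (ψ : Fin (n + 1) → ℂ) :
    star ψ ⬝ᵥ (hoppingMatrix (n + 1) α φ *ᵥ ψ) =
      ∑ k : Fin n, (star (ψ k.succ) * (α * Complex.exp (Complex.I * φ) * ψ k.castSucc) +
        star (ψ k.castSucc) * (α * Complex.exp (-Complex.I * φ) * ψ k.succ)) := by
  rw [Finset.sum_add_distrib,
    ← Fin.sum_sum_ite_eq_add_one
      (fun i j => star (ψ i) * (α * Complex.exp (Complex.I * φ) * ψ j)),
    ← Fin.sum_sum_ite_eq_add_one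
      (fun j i => star (ψ i) * (α * Complex.exp (-Complex.I * φ) * ψ j)),
    Finset.sum_comm (f := fun (j i : Fin (n + 1)) => if (j : ℕ) = (i : ℕ) + 1 then
      star (ψ i) * (α * Complex.exp (-Complex.I * φ) * ψ j) else 0),
    ← Finset.sum_add_distrib]
  simp only [dotProduct, mulVec, hoppingMatrix, Matrix.of_apply, Finset.mul_sum,
    ← Finset.sum_add_distrib, Pi.star_apply]
  refine Finset.sum_congr rfl fun i _ => Finset.sum_congr rfl fun j _ => ?_
  split_ifs <;> first | omega | simp

theorem abs_re_dotProduct_hoppingMatrix_mulVec_le {n : ℕ} {α : ℝ} (hα : 0 ≤ α) (φ : ℝ)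
    {r : ℝ} {ψ : Fin (n + 1) → ℂ} (hψ : ∀ i, ‖ψ i‖ = r) :
    |(star ψ ⬝ᵥ (hoppingMatrix (n + 1) α φ *ᵥ ψ)).re| ≤ n * (2 * α * r ^ 2) := by
  have he : ‖Complex.exp (Complex.I * φ)‖ = 1 := by
    rw [mul_comm, Complex.norm_exp_ofReal_mul_I]
  have he' : ‖Complex.exp (-Complex.I * φ)‖ = 1 := by
    rw [show -Complex.I * (φ : ℂ) = ((-φ : ℝ) : ℂ) * Complex.I by push_cast; ring,
      Complex.norm_exp_ofReal_mul_I]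
  rw [dotProduct_hoppingMatrix_mulVec]
  refine (Complex.abs_re_le_norm _).trans ((norm_sum_le _ _).trans ?_)
  refine (Finset.sum_le_card_nsmul _ _ (2 * α * r ^ 2) fun k _ => ?_).trans (by simp)
  refine (norm_add_le _ _).trans (le_of_eq ?_)
  simp only [norm_mul, norm_star, hψ, he, he', Complex.norm_real, Real.norm_of_nonneg hα]
  ring

/-- The equal-modulus vector with phases in arithmetic progression. -/
noncomputable def planeWave (d : ℕ) (r θ : ℝ) : Fin d → ℂ :=
  fun i => r * Complex.exp (((θ * (i : ℕ) : ℝ) : ℂ) * Complex.I)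

theorem norm_planeWave {d : ℕ} {r : ℝ} (hr : 0 ≤ r) (θ : ℝ) (i : Fin d) :
    ‖planeWave d r θ i‖ = r := by
  rw [planeWave, norm_mul, Complex.norm_exp_ofReal_mul_I, Complex.norm_real,
    Real.norm_of_nonneg hr, mul_one]

theorem re_dotProduct_hoppingMatrix_mulVec_planeWave {n : ℕ} (α φ r θ : ℝ) :
    (star (planeWave (n + 1) r θ) ⬝ᵥ
      (hoppingMatrix (n + 1) α φ *ᵥ planeWave (n + 1) r θ)).re =
      n * (2 * α * r ^ 2 * Real.cos (φ - θ)) := by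
  have key : ∀ a b x : ℝ, star ((r : ℂ) * Complex.exp ((a : ℂ) * Complex.I)) *
      (α * Complex.exp (x * Complex.I) * (r * Complex.exp (b * Complex.I))) =
      ((α * r ^ 2 : ℝ) : ℂ) * Complex.exp (((x + b - a : ℝ) : ℂ) * Complex.I) := by
    intro a b x
    rw [show ((x + b - a : ℝ) : ℂ) * Complex.I =
      -(a * Complex.I) + x * Complex.I + b * Complex.I by push_cast; ring,
      Complex.exp_add, Complex.exp_add]
    simp only [Complex.star_def, map_mul, Complex.conj_ofReal, ← Complex.exp_conj, Complex.conj_I]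
    push_cast
    ring_nf
  rw [dotProduct_hoppingMatrix_mulVec]
  simp only [planeWave]
  rw [show Complex.I * (φ : ℂ) = φ * Complex.I by ring,
    show -Complex.I * (φ : ℂ) = ((-φ : ℝ) : ℂ) * Complex.I by push_cast; ring]
  simp only [key, Complex.re_sum, Complex.add_re, Complex.re_ofReal_mul,
    Complex.exp_ofReal_mul_I_re, Fin.val_succ, Fin.val_castSucc]
  rw [Finset.sum_congr rfl (g := fun _ => 2 * α * r ^ 2 * Real.cos (φ - θ))]
  · simp
  · intro k _
    rw [show φ + θ * (k : ℕ) - θ * ((k : ℕ) + 1 : ℕ) = φ - θ by push_cast; ring,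
      show -φ + θ * ((k : ℕ) + 1 : ℕ) - θ * (k : ℕ) = -(φ - θ) by push_cast; ring, Real.cos_neg]
    ring

theorem stmt17 {d : ℕ} (hd : 2 ≤ d) (α φ : ℝ) (hα : 0 < α) :
    let J : Matrix (Fin d) (Fin d) ℂ := Matrix.of fun i j =>
      if (i : ℕ) = (j : ℕ) + 1 then (α : ℂ) * Complex.exp (Complex.I * (φ : ℂ))
      else if (j : ℕ) = (i : ℕ) + 1 then (α : ℂ) * Complex.exp (-Complex.I * (φ : ℂ))
      else 0
    sSup { w : ℝ | ∃ ψ φ' : Fin d → ℂ,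
        (∀ i, ‖ψ i‖ = 1 / Real.sqrt d) ∧
        (∀ i, ‖φ' i‖ = 1 / Real.sqrt d) ∧
        w = (star ψ ⬝ᵥ (J *ᵥ ψ)).re - (star φ' ⬝ᵥ (J *ᵥ φ')).re } =
      4 * α * (1 - 1 / (d : ℝ)) := by
  intro J
  obtain ⟨n, rfl⟩ : ∃ n, d = n + 1 := ⟨d - 1, by omega⟩
  have hJ : J = hoppingMatrix (n + 1) α φ := rfl
  rw [hJ]
  have hr : 0 ≤ 1 / Real.sqrt (n + 1 : ℕ) := by positivity
  have hr2 : (1 / Real.sqrt (n + 1 : ℕ)) ^ 2 = 1 / ((n + 1 : ℕ) : ℝ) := by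
    rw [div_pow, Real.sq_sqrt (Nat.cast_nonneg _), one_pow]
  have hval : 4 * α * (1 - 1 / ((n + 1 : ℕ) : ℝ)) =
      n * (2 * α * (1 / Real.sqrt (n + 1 : ℕ)) ^ 2) +
        n * (2 * α * (1 / Real.sqrt (n + 1 : ℕ)) ^ 2) := by
    rw [hr2]
    push_cast
    field_simp
    ring
  rw [hval]
  refine IsGreatest.csSup_eq ⟨⟨planeWave _ _ φ, planeWave _ _ (φ + Real.pi),
    norm_planeWave hr φ, norm_planeWave hr _, ?_⟩, ?_⟩
  · rw [re_dotProduct_hoppingMatrix_mulVec_planeWave,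
      re_dotProduct_hoppingMatrix_mulVec_planeWave, sub_self,
      show φ - (φ + Real.pi) = -Real.pi by ring, Real.cos_neg, Real.cos_pi, Real.cos_zero]
    ring
  · rintro w ⟨ψ, χ, hψ, hχ, rfl⟩
    have h₁ := (abs_le.mp (abs_re_dotProduct_hoppingMatrix_mulVec_le hα.le φ hψ)).2
    have h₂ := (abs_le.mp (abs_re_dotProduct_hoppingMatrix_mulVec_le hα.le φ hχ)).1
    linarith
end
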